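/- Let G be a finite group. If i_1 < i_2 < … < i_j are integers (j a positive integer), f_1, …, f_j ∈ G, and the product x^{i_1}·σ_{f_1}·x^{−i_1} · x^{i_2}·σ_{f_2}·x^{−i_2} ⋯ x^{i_j}·σ_{f_j}·x^{−i_j} is the identity permutation of G^ω, then f_l = 1 for every l with 1 ≤ l ≤ j. -/

import Mathlib

/-- The Cayley machine transformation of a group `G` at state `g`, acting on right-infinite
words `w : ℕ → G`: `(cayley g w) n = g * w 0 * w 1 * ⋯ * w n`. -/
def cayley {G : Type*} [Group G] (g : G) : Equiv.Perm (ℕ → G) where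
  toFun w n := g * ((List.range (n + 1)).map w).prod
  invFun v n :=
    match n with
    | 0 => g⁻¹ * v 0
    | m + 1 => (v m)⁻¹ * v (m + 1)
  left_inv w := by
    funext n
    match n with
    | 0 => simp [List.range_succ]
    | m + 1 => simp [List.range_succ, mul_assoc]
  right_inv v := by
    funext n
    induction n with
    | zero => simp [List.range_succ]
    | succ m ih =>
      beta_reduce at ih ⊢
      rw [List.range_succ, List.map_append, List.prod_append, ← mul_assoc, ih]
      simp [mul_assoc]

/-- The permutation `x = C₁⁻¹`, the inverse of the Cayley machine transformation at the
identity state.  It satisfies `(x w) 0 = w 0` and `(x w) n = (w (n-1))⁻¹ * w n` for `n ≥ 1`. -/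
def xPerm (G : Type*) [Group G] : Equiv.Perm (ℕ → G) := (cayley (1 : G))⁻¹

/-- The permutation `σ_g = x * C_g`, given by `(σ_g w) 0 = g * w 0` and `(σ_g w) n = w n`
for `n ≥ 1`.  The map `g ↦ σ_g` identifies `G` with a subgroup of the automata group. -/
def sigma' {G : Type*} [Group G] (g : G) : Equiv.Perm (ℕ → G) := xPerm G * cayley g

theorem xPerm_apply_succ {G : Type*} [Group G] (w : ℕ → G) (n : ℕ) :
    xPerm G w (n + 1) = (w n)⁻¹ * w (n + 1) := rfl

theorem xPerm_one {G : Type*} [Group G] : xPerm G (1 : ℕ → G) = 1 := by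
  funext n
  cases n <;> simp [xPerm, cayley, Equiv.Perm.inv_def, Equiv.symm]

theorem xPerm_zpow_one {G : Type*} [Group G] (k : ℤ) : (xPerm G ^ k) (1 : ℕ → G) = 1 :=
  Function.IsFixedPt.perm_zpow xPerm_one k

theorem sigma'_apply_zero {G : Type*} [Group G] (g : G) (w : ℕ → G) :
    sigma' g w 0 = g * w 0 := by
  simp [sigma', xPerm, cayley, Equiv.Perm.inv_def, Equiv.symm]

theorem sigma'_apply_succ {G : Type*} [Group G] (g : G) (w : ℕ → G) (n : ℕ) :
    sigma' g w (n + 1) = w (n + 1) := by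
  simp [sigma', xPerm_apply_succ, cayley, List.range_succ, mul_assoc]

theorem sigma'_one {G : Type*} [Group G] : sigma' (1 : G) = 1 := by
  simp [sigma', xPerm]

/-- `d` is the last position at which the word `w` has a nontrivial letter. -/
def IsLastNontrivial {G : Type*} [Group G] (w : ℕ → G) (d : ℕ) : Prop :=
  w d ≠ 1 ∧ ∀ n, d < n → w n = 1

theorem IsLastNontrivial.xPerm {G : Type*} [Group G] {w : ℕ → G} {d : ℕ}
    (h : IsLastNontrivial w d) : IsLastNontrivial (xPerm G w) (d + 1) := by
  refine ⟨by simpa [xPerm_apply_succ, h.2 (d + 1) (Nat.lt_succ_self d)] using h.1, ?_⟩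
  rintro (_ | n) hn
  · omega
  · simp [xPerm_apply_succ, h.2 n (by omega), h.2 (n + 1) (by omega)]

theorem IsLastNontrivial.xPerm_pow {G : Type*} [Group G] {w : ℕ → G} {d : ℕ}
    (h : IsLastNontrivial w d) (k : ℕ) : IsLastNontrivial ((_root_.xPerm G ^ k) w) (d + k) := by
  induction k with
  | zero => exact h
  | succ k ih => rw [pow_succ']; exact ih.xPerm

theorem IsLastNontrivial.sigma' {G : Type*} [Group G] {w : ℕ → G} {d : ℕ}
    (h : IsLastNontrivial w (d + 1)) (g : G) : IsLastNontrivial (sigma' g w) (d + 1) := by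
  refine ⟨by simpa [sigma'_apply_succ] using h.1, ?_⟩
  rintro (_ | n) hn
  · omega
  · rw [sigma'_apply_succ, h.2 _ hn]

theorem isLastNontrivial_sigma'_one {G : Type*} [Group G] {g : G} (hg : g ≠ 1) :
    IsLastNontrivial (sigma' g 1) 0 := by
  refine ⟨by simpa [sigma'_apply_zero] using hg, ?_⟩
  rintro (_ | n) hn
  · omega
  · simp [sigma'_apply_succ]

theorem not_isLastNontrivial_one {G : Type*} [Group G] (d : ℕ) :
    ¬ IsLastNontrivial (1 : ℕ → G) d := fun h => h.1 rfl

/-- A product of conjugates `x ^ i * σ_f * x ^ (-i)` with increasing exponents and some nontrivial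
`f` sends the trivial word to a nontrivial word of finite support, and so does any
`x ^ (-m)` times this product as long as `m` is at most all exponents. -/
theorem eq_one_or_isLastNontrivial {G : Type*} [Group G] (j : ℕ) (i : Fin j → ℤ)
    (hi : StrictMono i) (f : Fin j → G) :
    (∀ l, f l = 1) ∨ ∀ m : ℤ, (∀ l, m ≤ i l) → ∃ d, IsLastNontrivial
      ((xPerm G ^ (-m)) ((List.ofFn fun l => xPerm G ^ i l * sigma' (f l) *
        (xPerm G ^ i l)⁻¹).prod 1)) d := by
  induction j with
  | zero => exact Or.inl fun l => l.elim0
  | succ j ih =>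
    simp only [List.ofFn_succ, List.prod_cons]
    set P := (List.ofFn fun l : Fin j => xPerm G ^ i l.succ * sigma' (f l.succ) *
      (xPerm G ^ i l.succ)⁻¹).prod with hP
    have split (m : ℤ) (hm : m ≤ i 0) : ∃ k : ℕ,
        (xPerm G ^ (-m)) ((xPerm G ^ i 0 * sigma' (f 0) * (xPerm G ^ i 0)⁻¹ * P) 1) =
        (xPerm G ^ k) (sigma' (f 0) ((xPerm G ^ (-i 0)) (P 1))) := by
      obtain ⟨k, hk⟩ := Int.le.dest hm
      refine ⟨k, ?_⟩
      simp only [← Equiv.Perm.mul_apply, ← mul_assoc, ← zpow_add, ← zpow_neg, ← zpow_natCast]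
      rw [show -m + i 0 = k by omega]
    rcases ih (fun l => i l.succ) (hi.comp Fin.strictMono_succ) (fun l => f l.succ) with h | h
    · by_cases h0 : f 0 = 1
      · exact Or.inl fun l => Fin.cases h0 h l
      · refine Or.inr fun m hm => ?_
        obtain ⟨k, hk⟩ := split m (hm 0)
        have hP1 : P = 1 := by
          simp [hP, h, sigma'_one]
        rw [hk, hP1, Equiv.Perm.one_apply, xPerm_zpow_one]
        exact ⟨_, (isLastNontrivial_sigma'_one h0).xPerm_pow k⟩
    · refine Or.inr fun m hm => ?_
      obtain ⟨k, hk⟩ := split m (hm 0)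
      obtain ⟨d, hd⟩ := h (i 0 + 1) fun l => hi (Fin.succ_pos l)
      have hx := hd.xPerm
      rw [← Equiv.Perm.mul_apply, ← zpow_one_add, show 1 + -(i 0 + 1) = -i 0 by ring] at hx
      rw [hk]
      exact ⟨_, (hx.sigma' (f 0)).xPerm_pow k⟩

/-- Let `G` be a finite group.  If `i₁ < i₂ < … < i_j` are integers (`j ≥ 1`),
`f₁, …, f_j ∈ G`, and the product
`x^{i₁} σ_{f₁} x^{-i₁} ⋯ x^{i_j} σ_{f_j} x^{-i_j}` is the identity permutation of `G^ω`,
then every `f_l` is trivial. -/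
theorem product_trivial_implies_trivial {G : Type*} [Group G] [Finite G]
    (j : ℕ) (hj : 0 < j) (i : Fin j → ℤ) (hi : StrictMono i) (f : Fin j → G)
    (hprod : (List.ofFn (fun l : Fin j =>
        xPerm G ^ i l * sigma' (f l) * (xPerm G ^ i l)⁻¹)).prod = 1) :
    ∀ l : Fin j, f l = 1 := by
  rcases eq_one_or_isLastNontrivial j i hi f with h | h
  · exact h
  · obtain ⟨d, hd⟩ := h (i ⟨0, hj⟩) fun l => hi.monotone (Nat.zero_le _)
    rw [hprod, Equiv.Perm.one_apply, xPerm_zpow_one] at hd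
    exact (not_isLastNontrivial_one d hd).elim
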